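/- A set X ⊆ ℕ is both reticently high for paths and loquaciously high for paths if and only if WF = {e : T_e is well-founded} is computable from X. -/

import Mathlib

namespace CFT

open Nat.Partrec (Code)

/-- Relativized partial recursive functions: `f` is partial recursive in the
(total) oracle `O : ℕ → ℕ`.  This mirrors Mathlib's `Nat.Partrec`, with an
extra constructor for the oracle. -/
inductive RecursiveIn (O : ℕ → ℕ) : (ℕ →. ℕ) → Prop
  | zero : RecursiveIn O (pure 0)
  | succ : RecursiveIn O Nat.succ
  | left : RecursiveIn O ↑fun n : ℕ => n.unpair.1
  | right : RecursiveIn O ↑fun n : ℕ => n.unpair.2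
  | oracle : RecursiveIn O ↑O
  | pair {f g} : RecursiveIn O f → RecursiveIn O g →
      RecursiveIn O fun n => Nat.pair <$> f n <*> g n
  | comp {f g} : RecursiveIn O f → RecursiveIn O g →
      RecursiveIn O fun n => g n >>= f
  | prec {f g} : RecursiveIn O f → RecursiveIn O g →
      RecursiveIn O (Nat.unpaired fun a n =>
        n.rec (f a) fun y IH => do let i ← IH; g (Nat.pair a (Nat.pair y i)))
  | rfind {f} : RecursiveIn O f →
      RecursiveIn O fun a => Nat.rfind fun n => (fun m => m = 0) <$> f (Nat.pair a n)

/-- Partial functions between `Primcodable` types that are partial recursive in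
the oracle `O`. -/
def PartrecIn (O : ℕ → ℕ) {α σ : Type} [Primcodable α] [Primcodable σ] (f : α →. σ) : Prop :=
  RecursiveIn O fun n =>
    Part.bind (Part.ofOption (Encodable.decode (α := α) n)) fun a => (f a).map Encodable.encode

/-- Total functions between `Primcodable` types that are computable in the oracle `O`. -/
def ComputableIn (O : ℕ → ℕ) {α σ : Type} [Primcodable α] [Primcodable σ] (f : α → σ) : Prop :=
  PartrecIn O (f : α →. σ)

open Classical in
/-- The characteristic function of a set of naturals. -/
noncomputable def chi (A : Set ℕ) : ℕ → ℕ := fun n => if n ∈ A then 1 else 0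

/-- `A` is computably enumerable in (the characteristic function of) `X`. -/
def CEIn (X : Set ℕ) (A : Set ℕ) : Prop :=
  ∃ f : ℕ →. ℕ, PartrecIn (chi X) f ∧ ∀ n, n ∈ A ↔ (f n).Dom

/-- The `e`-th partial computable function `ℕ →. ℕ`. -/
def codeFn (e : ℕ) : ℕ →. ℕ := (Denumerable.ofNat Code e).eval

/-! ### Trees on ℕ -/

def PrefixClosed (T : Set (List ℕ)) : Prop := ∀ l ∈ T, ∀ l' : List ℕ, l' <+: l → l' ∈ T

/-- Index `e` decides a (prefix-closed) tree on `ℕ`. -/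
def DecidesTree (e : ℕ) : Prop :=
  (∀ n, (codeFn e n).Dom) ∧
    PrefixClosed {l : List ℕ | codeFn e (Encodable.encode l) = Part.some 1}

open Classical in
/-- The standard enumeration of computable trees on ℕ; indices that do not
decide a tree denote the empty tree. -/
noncomputable def treeAt (e : ℕ) : Set (List ℕ) :=
  if DecidesTree e then {l : List ℕ | codeFn e (Encodable.encode l) = Part.some 1} else ∅

/-- `f` is a path through the tree `T`: every finite initial segment
`[f 0, …, f (k-1)]` is in `T`. -/
def IsPath (T : Set (List ℕ)) (f : ℕ → ℕ) : Prop := ∀ k, (List.range k).map f ∈ T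

def IllFounded (T : Set (List ℕ)) : Prop := ∃ f, IsPath T f

/-- The set of indices of well-founded computable trees. -/
def WF : Set ℕ := {e | ¬ IllFounded (treeAt e)}

/-- `T` is a computable tree (prefix-closed and decided by a total computable function). -/
def ComputableTree (T : Set (List ℕ)) : Prop :=
  PrefixClosed T ∧ ∃ χ : List ℕ → Bool, Computable χ ∧ ∀ l, l ∈ T ↔ χ l = true

/-! ### Highness notions for paths -/

def HighForPaths (X : Set ℕ) : Prop :=
  ∀ T : Set (List ℕ), ComputableTree T → IllFounded T →
    ∃ f : ℕ → ℕ, ComputableIn (chi X) f ∧ IsPath T f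

def LoqHighForPaths (X : Set ℕ) : Prop :=
  ∃ F : ℕ × ℕ → ℕ, ComputableIn (chi X) F ∧
    ∀ e, IllFounded (treeAt e) → IsPath (treeAt e) fun n => F (e, n)

def UnifHighForPaths (X : Set ℕ) : Prop :=
  ∃ F : ℕ × ℕ →. ℕ, PartrecIn (chi X) F ∧
    ∀ e, IllFounded (treeAt e) →
      ∃ g : ℕ → ℕ, IsPath (treeAt e) g ∧ ∀ n, F (e, n) = Part.some (g n)

def RetHighForPaths (X : Set ℕ) : Prop :=
  ∃ F : ℕ × ℕ →. ℕ, PartrecIn (chi X) F ∧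
    (∀ e, IllFounded (treeAt e) →
      ∃ g : ℕ → ℕ, IsPath (treeAt e) g ∧ ∀ n, F (e, n) = Part.some (g n)) ∧
    (∀ e, ¬ IllFounded (treeAt e) → ∀ n, ¬ (F (e, n)).Dom)

/-! ### Σ¹₁ and Π¹₁ sets -/

def Sigma11 (A : Set ℕ) : Prop :=
  ∃ R : ℕ → List ℕ → Bool, Computable₂ R ∧
    ∀ n, n ∈ A ↔ ∃ f : ℕ → ℕ, ∀ k, R n ((List.range k).map f) = true

def Pi11 (A : Set ℕ) : Prop := Sigma11 Aᶜ

/-! ### Linear orders -/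

/-- A (presentation of a) linear order: a domain `D ⊆ ℕ` and a strict order
relation on it. -/
structure LinOrd where
  dom : Set ℕ
  lt : ℕ → ℕ → Prop

/-- `L` really is a strict linear order on its domain. -/
def LinOrd.IsValid (L : LinOrd) : Prop :=
  (∀ a b, L.lt a b → a ∈ L.dom ∧ b ∈ L.dom) ∧
  (∀ a, ¬ L.lt a a) ∧
  (∀ a b c, L.lt a b → L.lt b c → L.lt a c) ∧
  (∀ a ∈ L.dom, ∀ b ∈ L.dom, a = b ∨ L.lt a b ∨ L.lt b a)

def linOrdOfCodes (n : ℕ) : LinOrd :=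
  ⟨{a | codeFn n.unpair.1 a = Part.some 1},
   fun a b => codeFn n.unpair.2 (Nat.pair a b) = Part.some 1⟩

def DecidesLinOrd (n : ℕ) : Prop :=
  (∀ m, (codeFn n.unpair.1 m).Dom) ∧ (∀ m, (codeFn n.unpair.2 m).Dom) ∧
    (linOrdOfCodes n).IsValid

open Classical in
/-- The standard enumeration of computable linear orders; indices that do not
decide a linear order denote the empty order. -/
noncomputable def linOrdAt (n : ℕ) : LinOrd :=
  if DecidesLinOrd n then linOrdOfCodes n else ⟨∅, fun _ _ => False⟩

def IsDescSeq (L : LinOrd) (f : ℕ → ℕ) : Prop :=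
  ∀ i, f i ∈ L.dom ∧ L.lt (f (i + 1)) (f i)

def LinOrd.IllFounded (L : LinOrd) : Prop := ∃ f, IsDescSeq L f

/-- A tight descending sequence: a descending sequence that gets below every
descending sequence. -/
def IsTightDescSeq (L : LinOrd) (f : ℕ → ℕ) : Prop :=
  IsDescSeq L f ∧ ∀ g, IsDescSeq L g → ∀ n, ∃ m, L.lt (f m) (g n)

/-- `L` is a computable linear order. -/
def ComputableLinOrd (L : LinOrd) : Prop :=
  L.IsValid ∧
  (∃ χ : ℕ → Bool, Computable χ ∧ ∀ a, a ∈ L.dom ↔ χ a = true) ∧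
  (∃ χ : ℕ → ℕ → Bool, Computable₂ χ ∧ ∀ a b, L.lt a b ↔ χ a b = true)

def LoqHighForDS (X : Set ℕ) : Prop :=
  ∃ g : ℕ × ℕ → ℕ, ComputableIn (chi X) g ∧
    ∀ n, (linOrdAt n).IllFounded → IsDescSeq (linOrdAt n) fun k => g (n, k)

def HighForTightDS (X : Set ℕ) : Prop :=
  ∀ L : LinOrd, ComputableLinOrd L → L.IllFounded →
    ∃ f : ℕ → ℕ, ComputableIn (chi X) f ∧ IsTightDescSeq L f

def UnifHighForTightDS (X : Set ℕ) : Prop :=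
  ∃ F : ℕ × ℕ →. ℕ, PartrecIn (chi X) F ∧
    ∀ n, (linOrdAt n).IllFounded →
      ∃ g : ℕ → ℕ, IsTightDescSeq (linOrdAt n) g ∧ ∀ k, F (n, k) = Part.some (g k)

/-! ### Binary trees -/

def PrefixClosedB (B : Set (List Bool)) : Prop := ∀ l ∈ B, ∀ l' : List Bool, l' <+: l → l' ∈ B

def DecidesBTree (e : ℕ) : Prop :=
  (∀ n, (codeFn e n).Dom) ∧
    PrefixClosedB {l : List Bool | codeFn e (Encodable.encode l) = Part.some 1}

open Classical in
/-- The standard enumeration of computable binary trees; indices that do not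
decide a binary tree denote the full binary tree. -/
noncomputable def bTreeAt (e : ℕ) : Set (List Bool) :=
  if DecidesBTree e then {l : List Bool | codeFn e (Encodable.encode l) = Part.some 1}
  else Set.univ

def BInfinite (B : Set (List Bool)) : Prop := ∀ k, ∃ l ∈ B, l.length = k

def IsBPath (B : Set (List Bool)) (p : ℕ → Bool) : Prop := ∀ k, (List.range k).map p ∈ B


/-! ### Closure properties of relative computability -/

section Closure

variable {O : ℕ → ℕ} {α β σ : Type} [Primcodable α] [Primcodable β] [Primcodable σ]

theorem RecursiveIn.of_eq {f g : ℕ →. ℕ} (hf : RecursiveIn O f) (H : ∀ n, f n = g n) :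
    RecursiveIn O g :=
  (funext H : f = g) ▸ hf

theorem RecursiveIn.of_partrec {f : ℕ →. ℕ} (hf : Nat.Partrec f) : RecursiveIn O f := by
  induction hf with
  | zero => exact .zero
  | succ => exact .succ
  | left => exact .left
  | right => exact .right
  | pair _ _ hf hg => exact .pair hf hg
  | comp _ _ hf hg => exact .comp hf hg
  | prec _ _ hf hg => exact .prec hf hg
  | rfind _ hf => exact .rfind hf

theorem partrecIn_nat_iff {f : ℕ →. ℕ} : PartrecIn O f ↔ RecursiveIn O f := by
  simp [PartrecIn, Part.map_id']

theorem PartrecIn.of_eq {f g : α →. σ} (hf : PartrecIn O f) (H : ∀ a, f a = g a) :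
    PartrecIn O g :=
  (funext H : f = g) ▸ hf

theorem ComputableIn.of_eq {f g : α → σ} (hf : ComputableIn O f) (H : ∀ a, f a = g a) :
    ComputableIn O g :=
  (funext H : f = g) ▸ hf

theorem ComputableIn.of_computable {f : α → σ} (hf : Computable f) : ComputableIn O f :=
  RecursiveIn.of_partrec hf

theorem ComputableIn.of_primrec {f : α → σ} (hf : Primrec f) : ComputableIn O f :=
  .of_computable hf.to_comp

theorem ComputableIn.oracle : ComputableIn O O :=
  partrecIn_nat_iff.2 .oracle

theorem PartrecIn.comp {f : β →. σ} {g : α → β} (hf : PartrecIn O f) (hg : ComputableIn O g) :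
    PartrecIn O fun a => f (g a) :=
  (RecursiveIn.comp hf hg).of_eq fun n => by
    simp only [PFun.coe_val, Part.map_some, Part.bind_eq_bind]
    rcases e : Encodable.decode (α := α) n with - | a <;> simp

theorem ComputableIn.comp {f : β → σ} {g : α → β} (hf : ComputableIn O f)
    (hg : ComputableIn O g) : ComputableIn O fun a => f (g a) :=
  PartrecIn.comp (f := (f : β →. σ)) hf hg

theorem ComputableIn.pair {f : α → β} {g : α → σ} (hf : ComputableIn O f)
    (hg : ComputableIn O g) : ComputableIn O fun a => (f a, g a) :=
  (RecursiveIn.pair hf hg).of_eq fun n => by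
    cases Encodable.decode (α := α) n <;> simp [Seq.seq]

theorem PartrecIn.bind {f : α →. β} {g : α × β →. σ} (hf : PartrecIn O f)
    (hg : PartrecIn O g) : PartrecIn O fun a => (f a).bind fun b => g (a, b) :=
  (RecursiveIn.comp hg (RecursiveIn.pair (.of_partrec Nat.Partrec.some) hf)).of_eq fun n => by
    rcases e : Encodable.decode (α := α) n <;> simp [Seq.seq, e]

theorem ComputableIn.nat_rec {g : α → σ} {h : α × ℕ × σ → σ} (hg : ComputableIn O g)
    (hh : ComputableIn O h) :
    ComputableIn O fun p : α × ℕ => (p.2.rec (g p.1) fun y s => h (p.1, y, s) : σ) :=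
  (RecursiveIn.prec hg hh).of_eq fun n => by
    rcases e : Encodable.decode (α := α) n.unpair.1 with - | a
    · simp only [Nat.unpaired, e]
      induction n.unpair.2 <;> simp_all
    · simp [Nat.unpaired, e]
      generalize n.unpair.2 = k
      induction k <;> simp_all

theorem PartrecIn.rfind {p : α × ℕ → Bool} (hp : ComputableIn O p) :
    PartrecIn O fun a => Nat.rfind fun n => Part.some (p (a, n)) := by
  have hq : ComputableIn O fun x : α × ℕ => if p x then 0 else 1 :=
    ComputableIn.comp (f := fun b : Bool => if b then 0 else 1)
      (.of_primrec (Primrec.dom_finite _)) hp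
  refine (RecursiveIn.rfind hq).of_eq fun n => ?_
  rcases e : Encodable.decode (α := α) n with - | a
  · simpa [e] using Nat.rfind_zero_none _ rfl
  · simp [e, Part.map_id']

theorem ComputableIn.find {p : α × ℕ → Bool} (hp : ComputableIn O p)
    (h : ∀ a, ∃ n, p (a, n) = true) : ComputableIn O fun a => Nat.find (h a) :=
  (PartrecIn.rfind hp).of_eq fun a => Part.eq_some_iff.2 <| Nat.mem_rfind.2
    ⟨by simpa using (Nat.find_spec (h a)).symm,
      fun hm => by simpa using ((Bool.not_eq_true _).mp (Nat.find_min (h a) hm)).symm⟩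

theorem ComputableIn.map_range {g : α × ℕ → σ} (hg : ComputableIn O g) :
    ComputableIn O fun p : α × ℕ => (List.range p.2).map fun i => g (p.1, i) := by
  have hstep : ComputableIn O fun x : α × ℕ × List σ => x.2.2 ++ [g (x.1, x.2.1)] :=
    ComputableIn.comp (f := fun y : List σ × σ => y.1 ++ [y.2])
      (.of_primrec Primrec.list_concat)
      (.pair (.of_primrec (Primrec.snd.comp Primrec.snd))
        (hg.comp (.of_primrec (Primrec.fst.pair (Primrec.fst.comp Primrec.snd)))))
  refine (ComputableIn.nat_rec (.of_primrec (Primrec.const [])) hstep).of_eq fun p => ?_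
  induction p.2 with
  | zero => rfl
  | succ n ih => simp [List.range_succ, ← ih]

end Closure

/-! ### Finite-use approximations -/

open Filter in
/-- Every function recursive in `O` is the limit of a primitive recursive functional evaluated
on initial segments of `O`. -/
theorem RecursiveIn.exists_approx {O : ℕ → ℕ} {f : ℕ →. ℕ} (hf : RecursiveIn O f) :
    ∃ Φ : List ℕ → ℕ → Option ℕ, Primrec₂ Φ ∧
      (∀ m n v, v ∈ Φ ((List.range m).map O) n → v ∈ f n) ∧
      ∀ n v, v ∈ f n → ∀ᶠ m in atTop, v ∈ Φ ((List.range m).map O) n := by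
  induction hf with
  | zero => exact ⟨fun _ _ => some 0, Primrec.const _, by simp [pure, PFun.pure],
      by simp [pure, PFun.pure]⟩
  | succ =>
    exact ⟨fun _ n => some n.succ, Primrec.option_some.comp (Primrec.succ.comp Primrec.snd),
      by simp, by simp⟩
  | left =>
    exact ⟨fun _ n => some n.unpair.1,
      Primrec.option_some.comp (Primrec.fst.comp (Primrec.unpair.comp Primrec.snd)),
      by simp [eq_comm], by simp [eq_comm]⟩
  | right =>
    exact ⟨fun _ n => some n.unpair.2,
      Primrec.option_some.comp (Primrec.snd.comp (Primrec.unpair.comp Primrec.snd)),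
      by simp [eq_comm], by simp [eq_comm]⟩
  | oracle =>
    refine ⟨fun l n => l[n]?, Primrec.list_getElem?, ?_, ?_⟩
    · intro m n v h
      by_cases hn : n < m <;> simp_all [eq_comm]
    · intro n v h
      filter_upwards [eventually_gt_atTop n] with m hm
      simp_all
  | pair _ _ ihf ihg =>
    obtain ⟨Φ, hΦ, sΦ, cΦ⟩ := ihf
    obtain ⟨Ψ, hΨ, sΨ, cΨ⟩ := ihg
    refine ⟨fun l n => (Φ l n).bind fun a => (Ψ l n).map fun b => Nat.pair a b, ?_, ?_, ?_⟩
    · exact Primrec.option_bind hΦ (Primrec.option_map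
        (hΨ.comp (Primrec.fst.comp Primrec.fst) (Primrec.snd.comp Primrec.fst))
        (Primrec₂.natPair.comp (Primrec.snd.comp Primrec.fst) Primrec.snd))
    · intro m n v h
      simp only [Option.mem_def, Option.bind_eq_some_iff, Option.map_eq_some_iff] at h
      obtain ⟨a, ha, b, hb, rfl⟩ := h
      exact Part.mem_bind ((Part.mem_map_iff _).2 ⟨a, sΦ m n a ha, rfl⟩)
        ((Part.mem_map_iff _).2 ⟨b, sΨ m n b hb, rfl⟩)
    · intro n v h
      simp only [Seq.seq, Part.map_eq_map, Part.mem_bind_iff, Part.mem_map_iff,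
        exists_exists_and_eq_and] at h
      obtain ⟨a, ha, b, hb, rfl⟩ := h
      filter_upwards [cΦ n a ha, cΨ n b hb] with m h₁ h₂
      simp_all
  | comp _ _ ihf ihg =>
    obtain ⟨Φ, hΦ, sΦ, cΦ⟩ := ihf
    obtain ⟨Ψ, hΨ, sΨ, cΨ⟩ := ihg
    refine ⟨fun l n => (Ψ l n).bind fun a => Φ l a, ?_, ?_, ?_⟩
    · exact Primrec.option_bind hΨ (hΦ.comp (Primrec.fst.comp Primrec.fst) Primrec.snd)
    · intro m n v h
      simp only [Option.mem_def, Option.bind_eq_some_iff] at h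
      obtain ⟨a, ha, hv⟩ := h
      exact Part.mem_bind (sΨ m n a ha) (sΦ m a v hv)
    · intro n v h
      obtain ⟨a, ha, hv⟩ := Part.mem_bind_iff.1 h
      filter_upwards [cΨ n a ha, cΦ a v hv] with m h₁ h₂
      simp_all
  | @prec f g _ _ ihf ihg =>
    obtain ⟨Φ, hΦ, sΦ, cΦ⟩ := ihf
    obtain ⟨Ψ, hΨ, sΨ, cΨ⟩ := ihg
    refine ⟨fun l n => n.unpair.2.rec (Φ l n.unpair.1) fun y s =>
      s.bind fun i => Ψ l (Nat.pair n.unpair.1 (Nat.pair y i)), ?_, ?_, ?_⟩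
    · have hfst : Primrec fun p : List ℕ × ℕ => p.2.unpair.1 :=
        Primrec.fst.comp (Primrec.unpair.comp Primrec.snd)
      have hstep : Primrec₂ fun (p : List ℕ × ℕ) (q : ℕ × Option ℕ) =>
          q.2.bind fun i => Ψ p.1 (Nat.pair p.2.unpair.1 (Nat.pair q.1 i)) :=
        Primrec.option_bind (Primrec.snd.comp Primrec.snd)
          (hΨ.comp (Primrec.fst.comp (Primrec.fst.comp Primrec.fst))
            (Primrec₂.natPair.comp (hfst.comp (Primrec.fst.comp Primrec.fst))
              (Primrec₂.natPair.comp (Primrec.fst.comp (Primrec.snd.comp Primrec.fst))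
                Primrec.snd)))
      exact Primrec.nat_rec' (Primrec.snd.comp (Primrec.unpair.comp Primrec.snd))
        (hΦ.comp Primrec.fst hfst) hstep
    · intro m n v h
      simp only [Nat.unpaired] at h ⊢
      generalize n.unpair.2 = k at h ⊢
      induction k generalizing v with
      | zero => exact sΦ m _ v h
      | succ k ih =>
        simp only [Option.mem_def, Option.bind_eq_some_iff] at h
        obtain ⟨a, ha, hv⟩ := h
        exact Part.mem_bind (ih a ha) (sΨ m _ v hv)
    · intro n v h
      simp only [Nat.unpaired] at h ⊢
      generalize n.unpair.2 = k at h ⊢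
      induction k generalizing v with
      | zero => exact cΦ _ v h
      | succ k ih =>
        obtain ⟨a, ha, hv⟩ := Part.mem_bind_iff.1 h
        filter_upwards [ih a ha, cΨ _ v hv] with m h₁ h₂
        exact Option.bind_eq_some_iff.2 ⟨a, h₁, h₂⟩
  | @rfind f _ ihf =>
    obtain ⟨Φ, hΦ, sΦ, cΦ⟩ := ihf
    let p : List ℕ → ℕ → ℕ → Bool := fun l a i => decide ((Φ l (Nat.pair a i)).getD 0 = 0)
    let idx : List ℕ → ℕ → ℕ := fun l a => (List.range l.length).findIdx (p l a)
    have hidx : Primrec₂ idx := by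
      refine Primrec.list_findIdx (Primrec.list_range.comp (Primrec.list_length.comp Primrec.fst))
        (PrimrecRel.decide (Primrec.eq.comp (Primrec.option_getD.comp ?_ (Primrec.const 0))
          (Primrec.const 0)))
      exact hΦ.comp (Primrec.fst.comp Primrec.fst)
        (Primrec₂.natPair.comp (Primrec.snd.comp Primrec.fst) Primrec.snd)
    have hlt : ∀ l a i, i < idx l a → ∃ w, w + 1 ∈ Φ l (Nat.pair a i) := by
      intro l a i hi
      have := List.not_of_lt_findIdx hi
      simp only [List.getElem_range, p, decide_eq_false_iff_not] at this
      rcases hw : Φ l (Nat.pair a i) with - | w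
      · simp [hw] at this
      · exact ⟨w - 1, by simp [hw] at this ⊢; omega⟩
    refine ⟨fun l a => (Φ l (Nat.pair a (idx l a))).bind fun w =>
      if w = 0 then some (idx l a) else none, ?_, ?_, ?_⟩
    · exact Primrec.option_bind
        (hΦ.comp Primrec.fst (Primrec₂.natPair.comp Primrec.snd hidx))
        (Primrec.ite (Primrec.eq.comp Primrec.snd (Primrec.const 0))
          (Primrec.option_some.comp (hidx.comp (Primrec.fst.comp Primrec.fst)
            (Primrec.snd.comp Primrec.fst))) (Primrec.const none))
    · intro m n v h
      simp only [Option.mem_def, Option.bind_eq_some_iff, Option.ite_none_right_eq_some,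
        Option.some.injEq] at h
      obtain ⟨_, h₀, rfl, rfl⟩ := h
      refine Nat.mem_rfind.2 ⟨?_, fun {i} hi => ?_⟩
      · exact (Part.mem_map_iff _).2 ⟨0, sΦ _ _ _ h₀, by simp⟩
      · obtain ⟨w, hw⟩ := hlt _ _ _ hi
        exact (Part.mem_map_iff _).2 ⟨w + 1, sΦ _ _ _ hw, by simp⟩
    · intro n v h
      obtain ⟨h₀, hpos⟩ := Nat.mem_rfind.1 h
      have h₀' : 0 ∈ f (Nat.pair n v) := by simpa using h₀
      have hpos' : ∀ i < v, ∀ᶠ m in atTop,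
          ∃ w, w + 1 ∈ Φ ((List.range m).map O) (Nat.pair n i) := by
        intro i hi
        obtain ⟨w, hw, hw0⟩ := (Part.mem_map_iff _).1 (hpos hi)
        obtain ⟨w, rfl⟩ := Nat.exists_eq_succ_of_ne_zero (of_decide_eq_false hw0)
        exact (cΦ _ _ hw).mono fun m hm => ⟨w, hm⟩
      filter_upwards [cΦ _ _ h₀', (eventually_all_finite (Set.finite_lt_nat v)).2 hpos',
        eventually_gt_atTop v] with m h₁ h₂ h₃
      have hv : idx ((List.range m).map O) n = v := by
        simp only [idx, List.length_map, List.length_range]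
        refine (List.findIdx_eq (by simpa using h₃)).2 ⟨by simp_all [p], fun j hj => ?_⟩
        obtain ⟨w, hw⟩ := h₂ j hj
        simp_all [p]
      simp_all

/-! ### Indices of computable trees -/

theorem codeFn_partrec : Partrec₂ codeFn :=
  Code.eval_part.comp ((Computable.ofNat Code).comp .fst) .snd

theorem exists_index {α : Type} [Primcodable α] {f : α → ℕ →. ℕ} (hf : Partrec₂ f) :
    ∃ r : α → ℕ, Computable r ∧ ∀ a n, codeFn (r a) n = f a n := by
  obtain ⟨c, hc⟩ := Code.exists_code.1 hf
  refine ⟨fun a => Encodable.encode (Code.curry c (Encodable.encode a)), ?_, fun a n => ?_⟩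
  · exact Computable.encode.comp
      (Code.primrec₂_curry.to_comp.comp (Computable.const c) Computable.encode)
  · simp [codeFn, Code.eval_curry, hc, Part.map_id']

theorem DecidesTree.treeAt_eq {e : ℕ} (he : DecidesTree e) :
    treeAt e = {l | codeFn e (Encodable.encode l) = Part.some 1} :=
  if_pos he

theorem IllFounded.decidesTree {e : ℕ} (h : IllFounded (treeAt e)) : DecidesTree e := by
  by_contra he
  obtain ⟨f, hf⟩ := h
  simpa [treeAt, he] using hf 0

theorem not_mem_WF {e : ℕ} : e ∉ WF ↔ IllFounded (treeAt e) := not_not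

theorem exists_subtree_index :
    ∃ r : ℕ × List ℕ → ℕ, Computable r ∧
      ∀ e, DecidesTree e → ∀ σ, treeAt (r (e, σ)) = {τ | σ ++ τ ∈ treeAt e} := by
  obtain ⟨r, hr, hrf⟩ := exists_index (α := ℕ × List ℕ)
    (f := fun p x => codeFn p.1 (Encodable.encode (p.2 ++ Denumerable.ofNat (List ℕ) x)))
    (codeFn_partrec.comp (Computable.fst.comp .fst) (Computable.encode.comp
      (Computable.list_append.comp (Computable.snd.comp .fst)
        ((Computable.ofNat (List ℕ)).comp .snd))))
  refine ⟨r, hr, fun e he σ => ?_⟩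
  have hd : DecidesTree (r (e, σ)) := by
    refine ⟨fun n => by simpa [hrf] using he.1 _, fun l hl l' hl' => ?_⟩
    simp only [Set.mem_ofPred_eq, hrf, Denumerable.ofNat_encode] at hl ⊢
    exact he.2 _ hl _ ((List.prefix_append_right_inj σ).2 hl')
  simp [hd.treeAt_eq, he.treeAt_eq, hrf]

/-! ### Totalization

A path through the totalization of `e` is a path through `treeAt e` together with enough
computation stages to certify that `e` decides a tree. -/

/-- The entry `b` is an admissible successor of `τ` in the totalization of `e`. Its first component
extends the branch, its second component bounds the computations that are checked. -/
def Approves (e : ℕ) (τ : List ℕ) (b : ℕ) : Prop :=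
  ((Denumerable.ofNat Code e).evaln b.unpair.2 τ.length).isSome ∧
    ((Denumerable.ofNat Code e).evaln b.unpair.2 τ.length = some 1 →
      (Denumerable.ofNat Code e).evaln b.unpair.2
        (Encodable.encode (Denumerable.ofNat (List ℕ) τ.length).dropLast) = some 1) ∧
    (Denumerable.ofNat Code e).evaln b.unpair.2
      (Encodable.encode (τ.map fun x => x.unpair.1)) = some 1

def totalization (e : ℕ) : Set (List ℕ) :=
  {σ | ∀ i < σ.length, Approves e (σ.take i) (σ.getD i 0)}

theorem primrecPred_approves :
    PrimrecPred fun p : ℕ × List ℕ × ℕ => Approves p.1 p.2.1 p.2.2 := by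
  have hlen : Primrec fun p : ℕ × List ℕ × ℕ => p.2.1.length :=
    Primrec.list_length.comp (Primrec.fst.comp Primrec.snd)
  have hev {g : ℕ × List ℕ × ℕ → ℕ} (hg : Primrec g) : Primrec fun p : ℕ × List ℕ × ℕ =>
      (Denumerable.ofNat Code p.1).evaln p.2.2.unpair.2 (g p) :=
    Code.primrec_evaln.comp (((Primrec.snd.comp (Primrec.unpair.comp
      (Primrec.snd.comp Primrec.snd))).pair ((Primrec.ofNat Code).comp Primrec.fst)).pair hg)
  have heq {g : ℕ × List ℕ × ℕ → ℕ} (hg : Primrec g) : PrimrecPred fun p : ℕ × List ℕ × ℕ =>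
      (Denumerable.ofNat Code p.1).evaln p.2.2.unpair.2 (g p) = some 1 :=
    Primrec.eq.comp (hev hg) (Primrec.const _)
  have hdrop : Primrec fun l : List ℕ => l.dropLast :=
    (Primrec.list_take.comp (Primrec.nat_sub.comp Primrec.list_length (Primrec.const 1))
      Primrec.id).of_eq fun l => List.dropLast_eq_take.symm
  have hmap : Primrec fun l : List ℕ => l.map fun x => x.unpair.1 :=
    Primrec.list_map Primrec.id (Primrec.fst.comp (Primrec.unpair.comp Primrec.snd)).to₂
  refine PrimrecPred.and (Primrec.eq.comp (Primrec.option_isSome.comp (hev hlen))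
    (Primrec.const true)) (PrimrecPred.and (PrimrecPred.of_eq (PrimrecPred.or (heq hlen).not
      (heq (Primrec.encode.comp (hdrop.comp ((Primrec.ofNat (List ℕ)).comp hlen)))))
      fun p => imp_iff_not_or.symm) ?_)
  exact heq (Primrec.encode.comp (hmap.comp (Primrec.fst.comp Primrec.snd)))

theorem primrecRel_mem_totalization :
    PrimrecRel fun (e : ℕ) (σ : List ℕ) => σ ∈ totalization e := by
  have h : PrimrecRel fun (i : ℕ) (p : ℕ × List ℕ) =>
      Approves p.1 (p.2.take i) (p.2.getD i 0) :=
    primrecPred_approves.comp ((Primrec.fst.comp Primrec.snd).pair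
      ((Primrec.list_take.comp Primrec.fst (Primrec.snd.comp Primrec.snd)).pair
        ((Primrec.list_getD 0).comp (Primrec.snd.comp Primrec.snd) Primrec.fst)))
  exact (h.forall_mem_list.comp (Primrec.list_range.comp (Primrec.list_length.comp Primrec.snd))
    Primrec.id).of_eq fun p => by simp [totalization]

theorem prefixClosed_totalization (e : ℕ) : PrefixClosed (totalization e) := by
  rintro _ hl l ⟨t, rfl⟩ i hi
  have := hl i (by simp; omega)
  rwa [List.take_append_of_le_length hi.le, List.getD_append _ _ _ _ hi] at this

theorem isPath_totalization_iff {e : ℕ} {p : ℕ → ℕ} :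
    IsPath (totalization e) p ↔ ∀ i, Approves e ((List.range i).map p) (p i) := by
  refine ⟨fun h i => ?_, fun h k i hi => ?_⟩
  · simpa [← List.map_take, List.take_range] using h (i + 1) i (by simp)
  · have hi : i < k := by simpa using hi
    simpa [← List.map_take, List.take_range, hi, hi.le] using h i

theorem exists_index_totalization :
    ∃ h : ℕ → ℕ, Computable h ∧ ∀ e, treeAt (h e) = totalization e := by
  classical
  have hc : Computable₂ fun (e x : ℕ) =>
      if Denumerable.ofNat (List ℕ) x ∈ totalization e then 1 else 0 :=
    (Primrec.ite (primrecRel_mem_totalization.comp Primrec.fst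
      ((Primrec.ofNat (List ℕ)).comp Primrec.snd)) (Primrec.const 1) (Primrec.const 0)).to_comp
  obtain ⟨h, hh, hf⟩ := exists_index hc.partrec₂
  have hmem (e : ℕ) (l : List ℕ) :
      codeFn (h e) (Encodable.encode l) = Part.some 1 ↔ l ∈ totalization e := by
    simp [hf]
  refine ⟨h, hh, fun e => ?_⟩
  have hd : DecidesTree (h e) := by
    refine ⟨fun n => by simp [hf], ?_⟩
    simpa only [hmem] using! prefixClosed_totalization e
  simp [hd.treeAt_eq, hmem]

theorem illFounded_totalization {e : ℕ} :
    IllFounded (totalization e) ↔ IllFounded (treeAt e) := by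
  constructor
  · rintro ⟨p, hp⟩
    rw [isPath_totalization_iff] at hp
    have heval {k n v : ℕ} (h : (Denumerable.ofNat Code e).evaln k n = some v) :
        codeFn e n = Part.some v := Part.eq_some_iff.2 (Code.evaln_sound h)
    have hd : DecidesTree e := by
      have hdrop (l : List ℕ) (hl : codeFn e (Encodable.encode l) = Part.some 1) :
          codeFn e (Encodable.encode l.dropLast) = Part.some 1 := by
        obtain ⟨h₁, h₂, -⟩ := hp (Encodable.encode l)
        simp only [List.length_map, List.length_range, Denumerable.ofNat_encode] at h₁ h₂
        obtain ⟨v, hv⟩ := Option.isSome_iff_exists.1 h₁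
        obtain rfl : v = 1 := Part.some_inj.1 ((heval hv).symm.trans hl)
        exact heval (h₂ hv)
      refine ⟨fun n => ?_, ?_⟩
      · obtain ⟨v, hv⟩ := Option.isSome_iff_exists.1 (hp n).1
        simp only [List.length_map, List.length_range] at hv
        simp [heval hv]
      · rintro _ hl l ⟨t, rfl⟩
        induction t using List.reverseRecOn with
        | nil => simpa using hl
        | append_singleton t a ih =>
          exact ih (by simpa [← List.append_assoc] using hdrop _ hl)
    refine ⟨fun i => (p i).unpair.1, fun k => ?_⟩
    rw [hd.treeAt_eq]
    simpa [Function.comp_def] using heval (hp k).2.2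
  · intro hT
    have hd := hT.decidesTree
    obtain ⟨f, hf⟩ := hT
    rw [hd.treeAt_eq] at hf
    have hev {n v : ℕ} (h : codeFn e n = Part.some v) :
        ∀ᶠ s in Filter.atTop, (Denumerable.ofNat Code e).evaln s n = some v := by
      obtain ⟨k, hk⟩ := Code.evaln_complete.1 (Part.eq_some_iff.1 h)
      filter_upwards [Filter.eventually_ge_atTop k] with s hs
      exact Code.evaln_mono hs hk
    have hstage (i : ℕ) : ∃ s, ((Denumerable.ofNat Code e).evaln s i).isSome ∧
        ((Denumerable.ofNat Code e).evaln s i = some 1 →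
          (Denumerable.ofNat Code e).evaln s
            (Encodable.encode (Denumerable.ofNat (List ℕ) i).dropLast) = some 1) ∧
        (Denumerable.ofNat Code e).evaln s
          (Encodable.encode ((List.range i).map f)) = some 1 := by
      obtain ⟨v, hv⟩ := Part.dom_iff_mem.1 (hd.1 i)
      have hv := Part.eq_some_iff.2 hv
      by_cases h₁ : v = 1
      · subst h₁
        have hpre := hd.2 (Denumerable.ofNat (List ℕ) i) (by simpa using hv) _
          (List.dropLast_prefix _)
        obtain ⟨s, h₁, h₂, h₃⟩ := ((hev hv).and ((hev hpre).and (hev (hf i)))).exists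
        exact ⟨s, by simp [h₁], fun _ => h₂, h₃⟩
      · obtain ⟨s, h₁, h₂⟩ := ((hev hv).and (hev (hf i))).exists
        exact ⟨s, by simp [h₁], by simp_all, h₂⟩
    choose s hs using hstage
    refine ⟨fun i => Nat.pair (f i) (s i), isPath_totalization_iff.2 fun i => ?_⟩
    simpa [Approves, Function.comp_def] using hs i

/-! ### Computing `WF` from paths and conversely -/

theorem ComputableIn.primrec₂_comp {O : ℕ → ℕ} {α β γ σ : Type} [Primcodable α] [Primcodable β]
    [Primcodable γ] [Primcodable σ] {f : β → γ → σ} {g : α → β} {h : α → γ} (hf : Primrec₂ f)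
    (hg : ComputableIn O g) (hh : ComputableIn O h) : ComputableIn O fun a => f (g a) (h a) :=
  ComputableIn.comp (f := fun p : β × γ => f p.1 p.2) (.of_primrec hf) (hg.pair hh)

theorem ComputableIn.chi_of_semidecidable {O : ℕ → ℕ} {A : Set ℕ} {p q : ℕ × ℕ → Bool}
    (hp : ComputableIn O p) (hq : ComputableIn O q) (hpA : ∀ e, e ∈ A ↔ ∃ s, p (e, s) = true)
    (hqA : ∀ e, e ∉ A ↔ ∃ s, q (e, s) = true) : ComputableIn O (chi A) := by
  have h (e : ℕ) : ∃ s, (p (e, s) || q (e, s)) = true := by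
    by_cases he : e ∈ A
    · exact ((hpA e).1 he).imp fun s hs => by simp [hs]
    · exact ((hqA e).1 he).imp fun s hs => by simp [hs]
  have hfind := ComputableIn.find (.primrec₂_comp Primrec.or hp hq) h
  have hite : Primrec fun b : Bool => if b then 1 else 0 := Primrec.dom_finite _
  refine ((ComputableIn.of_primrec hite).comp
    (hp.comp ((ComputableIn.of_primrec Primrec.id).pair hfind))).of_eq fun e => ?_
  have hspec := Nat.find_spec (h e)
  generalize Nat.find (h e) = s at hspec ⊢
  by_cases he : e ∈ A
  · have : ¬ q (e, s) = true := fun hs => (hqA e).2 ⟨s, hs⟩ he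
    simp_all [chi]
  · have : ¬ p (e, s) = true := fun hs => he ((hpA e).2 ⟨s, hs⟩)
    simp_all [chi]

theorem PartrecIn.exists_stage {O : ℕ → ℕ} {f : ℕ →. ℕ} (hf : PartrecIn O f) :
    ∃ q : ℕ × ℕ → Bool, ComputableIn O q ∧ ∀ e, (f e).Dom ↔ ∃ s, q (e, s) = true := by
  obtain ⟨Φ, hΦ, sΦ, cΦ⟩ := (partrecIn_nat_iff.1 hf).exists_approx
  refine ⟨fun p => (Φ ((List.range p.2).map O) p.1).isSome, ?_, fun e => ⟨fun h => ?_, ?_⟩⟩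
  · exact .primrec₂_comp (Primrec.option_isSome.comp hΦ).to₂
      (ComputableIn.map_range (ComputableIn.oracle.comp (.of_primrec Primrec.snd)))
      (.of_primrec Primrec.fst)
  · obtain ⟨s, hs⟩ := (cΦ e _ (Part.get_mem h)).exists
    exact ⟨s, by simp_all⟩
  · rintro ⟨s, hs⟩
    obtain ⟨v, hv⟩ := Option.isSome_iff_exists.1 hs
    exact Part.dom_iff_mem.2 ⟨v, sΦ s e v hv⟩

theorem RetHighForPaths.exists_stage {X : Set ℕ} (hX : RetHighForPaths X) :
    ∃ q : ℕ × ℕ → Bool, ComputableIn (chi X) q ∧ ∀ e, e ∉ WF ↔ ∃ s, q (e, s) = true := by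
  obtain ⟨F, hF, hill, hwf⟩ := hX
  obtain ⟨q, hq, h⟩ := PartrecIn.exists_stage
    (hF.comp (.of_primrec (Primrec.id.pair (Primrec.const 0))))
  refine ⟨q, hq, fun e => ?_⟩
  rw [← h, not_mem_WF]
  refine ⟨fun he => ?_, fun hd => by_contra fun he => hwf e he 0 hd⟩
  obtain ⟨g, -, hg⟩ := hill e he
  simp [hg]

theorem LoqHighForPaths.exists_stage {X : Set ℕ} (hX : LoqHighForPaths X) :
    ∃ p : ℕ × ℕ → Bool, ComputableIn (chi X) p ∧ ∀ e, e ∈ WF ↔ ∃ s, p (e, s) = true := by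
  classical
  obtain ⟨G, hG, hpath⟩ := hX
  obtain ⟨h, hh, htree⟩ := exists_index_totalization
  refine ⟨fun x => decide ((List.range x.2).map (fun i => G (h x.1, i)) ∉ totalization x.1),
    ?_, fun e => ?_⟩
  · refine .primrec₂_comp (f := fun e σ => decide (σ ∉ totalization e))
      primrecRel_mem_totalization.not.decide (.of_primrec Primrec.fst)
      (ComputableIn.map_range (g := fun x => G (h x.1, x.2)) (hG.comp ?_))
    exact .of_computable ((hh.comp Computable.fst).pair Computable.snd)
  · rw [WF, Set.mem_ofPred_eq, ← illFounded_totalization, ← htree]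
    refine ⟨fun he => ?_, fun ⟨s, hs⟩ hill => ?_⟩
    · by_contra hs
      exact he ⟨fun i => G (h e, i), by simpa [IsPath, htree] using hs⟩
    · simp [← htree, hpath (h e) hill s] at hs

/-- An ill-founded tree has, uniformly in `WF`, a path. -/
theorem exists_path_of_computableIn_chi_WF {O : ℕ → ℕ} (hW : ComputableIn O (chi WF)) :
    ∃ g : ℕ × ℕ → ℕ, ComputableIn O g ∧
      ∀ e, IllFounded (treeAt e) → IsPath (treeAt e) fun n => g (e, n) := by
  classical
  obtain ⟨r, hr, htree⟩ := exists_subtree_index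
  have hdec : ComputableIn O fun e => decide (e ∈ WF) :=
    (ComputableIn.primrec₂_comp (Primrec.beq (α := ℕ)) hW (.of_primrec (Primrec.const 1))).of_eq
      fun e => by by_cases e ∈ WF <;> simp_all [chi]
  have happend : Primrec fun x : (ℕ × List ℕ) × ℕ => (x.1.1, x.1.2 ++ [x.2]) :=
    (Primrec.fst.comp Primrec.fst).pair
      (Primrec.list_concat.comp (Primrec.snd.comp Primrec.fst) Primrec.snd)
  have hgood : ComputableIn O fun x : (ℕ × List ℕ) × ℕ =>
      decide (x.1.1 ∈ WF) ||
        (decide (r x.1 ∈ WF) || !decide (r (x.1.1, x.1.2 ++ [x.2]) ∈ WF)) :=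
    .primrec₂_comp Primrec.or
      (hdec.comp (.of_primrec (Primrec.fst.comp Primrec.fst)))
      (.primrec₂_comp Primrec.or
        (hdec.comp (.comp (.of_computable hr) (.of_primrec Primrec.fst)))
        (.comp (.of_primrec Primrec.not)
          (hdec.comp (.comp (.of_computable hr) (.of_primrec happend)))))
  have hex (x : ℕ × List ℕ) : ∃ m, (decide (x.1 ∈ WF) ||
        (decide (r x ∈ WF) || !decide (r (x.1, x.2 ++ [m]) ∈ WF))) = true := by
    obtain ⟨e, σ⟩ := x
    by_cases he : e ∈ WF
    · simp [he]
    by_cases hσ : r (e, σ) ∈ WF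
    · simp [hσ]
    have hd := (not_mem_WF.1 he).decidesTree
    obtain ⟨f, hf⟩ := not_mem_WF.1 hσ
    refine ⟨f 0, ?_⟩
    have : r (e, σ ++ [f 0]) ∉ WF := by
      refine not_mem_WF.2 ⟨fun n => f (n + 1), fun k => ?_⟩
      have := hf (k + 1)
      simpa [htree e hd, List.range_succ_eq_map, Function.comp_def] using this
    simp [this]
  obtain ⟨G, hG, hspec⟩ : ∃ G : ℕ × List ℕ → ℕ, ComputableIn O G ∧ ∀ x,
      (decide (x.1 ∈ WF) || (decide (r x ∈ WF) || !decide (r (x.1, x.2 ++ [G x]) ∈ WF))) = true :=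
    ⟨_, .find hgood hex, fun x => Nat.find_spec (hex x)⟩
  have hL := ComputableIn.nat_rec (α := ℕ) (O := O) (g := fun _ => ([] : List ℕ))
    (h := fun x => x.2.2 ++ [G (x.1, x.2.2)]) (.of_primrec (Primrec.const []))
    (.primrec₂_comp (f := fun l m => l ++ [m]) Primrec.list_concat
      (.of_primrec (Primrec.snd.comp Primrec.snd))
      (hG.comp (.of_primrec (Primrec.fst.pair (Primrec.snd.comp Primrec.snd)))))
  set L : ℕ × ℕ → List ℕ :=
    fun p => p.2.rec [] fun _ l => l ++ [G (p.1, l)]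
  have hLsucc (e k : ℕ) : L (e, k + 1) = L (e, k) ++ [G (e, L (e, k))] := rfl
  refine ⟨fun p => G (p.1, L p), hG.comp ((ComputableIn.of_primrec Primrec.fst).pair hL),
    fun e he k => ?_⟩
  have hd := he.decidesTree
  have hmap : (List.range k).map (fun n => G (e, L (e, n))) = L (e, k) := by
    induction k with
    | zero => rfl
    | succ k ih => simp [List.range_succ, ih, hLsucc]
  have hill : r (e, L (e, k)) ∉ WF := by
    clear hmap
    induction k with
    | zero => simpa [not_mem_WF, htree e hd, L] using he
    | succ k ih => simpa [not_mem_WF.2 he, ih, hLsucc] using hspec (e, L (e, k))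
  obtain ⟨f, hf⟩ := not_mem_WF.1 hill
  rw [hmap]
  simpa [htree e hd] using hf 0

theorem loqHighForPaths_of_computableIn_chi_WF {X : Set ℕ} (hW : ComputableIn (chi X) (chi WF)) :
    LoqHighForPaths X :=
  exists_path_of_computableIn_chi_WF hW

theorem retHighForPaths_of_computableIn_chi_WF {X : Set ℕ} (hW : ComputableIn (chi X) (chi WF)) :
    RetHighForPaths X := by
  obtain ⟨g, hg, hpath⟩ := exists_path_of_computableIn_chi_WF hW
  have htest : ComputableIn (chi X) fun x : (ℕ × ℕ) × ℕ => chi WF x.1.1 == 0 :=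
    .primrec₂_comp Primrec.beq (hW.comp (.of_primrec (Primrec.fst.comp Primrec.fst)))
      (.of_primrec (Primrec.const 0))
  have hF := (PartrecIn.rfind htest).bind
    (g := fun x => Part.some (g x.1)) (hg.comp (.of_primrec Primrec.fst))
  refine ⟨_, hF, fun e he => ⟨fun n => g (e, n), hpath e he, fun n => ?_⟩, fun e he n h => ?_⟩
  · have : (0 : ℕ) ∈ Nat.rfind fun _ => Part.some (chi WF e == 0) :=
      Nat.mem_rfind.2 ⟨by simp [chi, not_mem_WF.2 he], by simp⟩
    simp [Part.eq_some_iff.2 this]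
  · obtain ⟨m, hm⟩ := Part.dom_iff_mem.1 h.1
    have hWF : e ∈ WF := he
    simpa [chi, hWF] using (Nat.mem_rfind.1 hm).1

/-- `X` is both reticently and loquaciously high for paths iff `WF` is
computable from `X`. -/
theorem retHigh_and_loqHigh_iff_computes_WF (X : Set ℕ) :
    (RetHighForPaths X ∧ LoqHighForPaths X) ↔ ComputableIn (chi X) (chi WF) := by
  refine ⟨fun ⟨hret, hloq⟩ => ?_, fun hW => ⟨retHighForPaths_of_computableIn_chi_WF hW,
    loqHighForPaths_of_computableIn_chi_WF hW⟩⟩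
  obtain ⟨q, hq, hqWF⟩ := hret.exists_stage
  obtain ⟨p, hp, hpWF⟩ := hloq.exists_stage
  exact .chi_of_semidecidable hp hq hpWF hqWF

end CFT
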